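/- Let m₁ ≥ m₂ ≥ 1 be integers and let κ ≥ 3·m₂ + 1 be real. Let (Ω, μ) be a finite measure space and let U, V : Ω → ℝ^{m₁×m₂} be strongly measurable functions such that ‖U(x)‖_F ≤ √m₂ and ‖V(x)‖_F ≤ √m₂ for μ-almost every x ∈ Ω. With f(W) = W − W·Wᵀ·W and F(W) = (1/4)·(WᵀW − I)² (I the m₂×m₂ identity), one has ∫_Ω ( tr(F(U(x))) − tr(F(V(x))) + ⟨U(x) − V(x), f(V(x))⟩_F ) dμ(x) ≤ (κ/2)·∫_Ω ‖U(x) − V(x)‖_F² dμ(x). -/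

import Mathlib

open Matrix MeasureTheory

/-- Frobenius norm of a real matrix. -/
noncomputable def frobNorm {α β : Type*} [Fintype α] [Fintype β]
    (A : Matrix α β ℝ) : ℝ :=
  Real.sqrt (∑ i, ∑ j, (A i j) ^ 2)

/-- Frobenius inner product `⟨A, B⟩_F = tr(AᵀB)`. -/
def frobInner {α β : Type*} [Fintype α] [Fintype β]
    (A B : Matrix α β ℝ) : ℝ :=
  trace (Aᵀ * B)

/-- The Allen--Cahn nonlinearity `f(W) = W − WWᵀW`. -/
def fAC {m₁ m₂ : ℕ} (W : Matrix (Fin m₁) (Fin m₂) ℝ) :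
    Matrix (Fin m₁) (Fin m₂) ℝ :=
  W - W * Wᵀ * W

/-- The matrix-valued Allen--Cahn potential `F(W) = (1/4)(WᵀW − I)²`. -/
noncomputable def FAC {m₁ m₂ : ℕ} (W : Matrix (Fin m₁) (Fin m₂) ℝ) :
    Matrix (Fin m₂) (Fin m₂) ℝ :=
  (1 / 4 : ℝ) • (Wᵀ * W - 1) ^ 2

section Pointwise

attribute [local instance] Matrix.frobeniusNormedAddCommGroup

theorem frobNorm_eq_norm {α β : Type*} [Fintype α] [Fintype β] (A : Matrix α β ℝ) :
    frobNorm A = ‖A‖ := by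
  simp [frobNorm, Matrix.frobenius_norm_def, Real.sqrt_eq_rpow]

theorem frobNorm_nonneg {α β : Type*} [Fintype α] [Fintype β] (A : Matrix α β ℝ) :
    0 ≤ frobNorm A :=
  Real.sqrt_nonneg _

theorem frobNorm_add_le {α β : Type*} [Fintype α] [Fintype β] (A B : Matrix α β ℝ) :
    frobNorm (A + B) ≤ frobNorm A + frobNorm B := by
  simpa only [frobNorm_eq_norm] using norm_add_le A B

theorem frobNorm_sub_le {α β : Type*} [Fintype α] [Fintype β] (A B : Matrix α β ℝ) :
    frobNorm (A - B) ≤ frobNorm A + frobNorm B := by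
  simpa only [frobNorm_eq_norm] using norm_sub_le A B

theorem frobNorm_mul_le {α β γ : Type*} [Fintype α] [Fintype β] [Fintype γ]
    (A : Matrix α β ℝ) (B : Matrix β γ ℝ) :
    frobNorm (A * B) ≤ frobNorm A * frobNorm B := by
  simpa only [frobNorm_eq_norm] using Matrix.frobenius_norm_mul A B

theorem frobNorm_transpose {α β : Type*} [Fintype α] [Fintype β] (A : Matrix α β ℝ) :
    frobNorm Aᵀ = frobNorm A := by
  simpa only [frobNorm_eq_norm] using Matrix.frobenius_norm_transpose A

end Pointwise

theorem frobNorm_sq {α β : Type*} [Fintype α] [Fintype β] (A : Matrix α β ℝ) :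
    frobNorm A ^ 2 = trace (Aᵀ * A) := by
  rw [frobNorm, Real.sq_sqrt (by positivity), Finset.sum_comm]
  simp [trace, Matrix.mul_apply, sq]

/-- The second-order Taylor remainder of `tr F` as a difference of squares. -/
theorem trace_FAC_remainder {m₁ m₂ : ℕ} (U V : Matrix (Fin m₁) (Fin m₂) ℝ) :
    trace (FAC U) - trace (FAC V) + frobInner (U - V) (fAC V) =
      (1 / 4) * (frobNorm (Uᵀ * (U - V) + (U - V)ᵀ * V) ^ 2
        + 2 * frobNorm (V * (U - V)ᵀ) ^ 2) - (1 / 2) * frobNorm (U - V) ^ 2 := by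
  have h₁ : trace (Vᵀ * V * (Uᵀ * U)) = trace (Uᵀ * U * (Vᵀ * V)) := trace_mul_comm _ _
  have h₂ : trace (Vᵀ * V * (Uᵀ * V)) = trace (Uᵀ * V * (Vᵀ * V)) := trace_mul_comm _ _
  have h₃ : trace (Vᵀ * V * (Vᵀ * U)) = trace (Uᵀ * V * (Vᵀ * V)) := by
    rw [← trace_transpose]
    simp only [transpose_mul, transpose_transpose]
  have h₄ : trace (Vᵀ * U) = trace (Uᵀ * V) := by
    rw [← trace_transpose, transpose_mul, transpose_transpose]
  have hS : Uᵀ * (U - V) + (U - V)ᵀ * V = Uᵀ * U - Vᵀ * V := by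
    rw [transpose_sub, Matrix.mul_sub, Matrix.sub_mul]
    abel
  have hR : frobNorm (V * (U - V)ᵀ) ^ 2 = trace (Vᵀ * V * ((U - V)ᵀ * (U - V))) := by
    rw [frobNorm_sq, transpose_mul, transpose_transpose, Matrix.mul_assoc, trace_mul_comm]
    simp only [Matrix.mul_assoc]
  have hf : (U - V)ᵀ * (V - V * Vᵀ * V) =
      Uᵀ * V - Uᵀ * V * (Vᵀ * V) - Vᵀ * V + Vᵀ * V * (Vᵀ * V) := by
    simp only [transpose_sub, Matrix.mul_sub, Matrix.sub_mul, Matrix.mul_assoc]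
    abel
  rw [hS, hR, frobNorm_sq, frobNorm_sq, frobInner, fAC, hf]
  simp only [FAC, sq, transpose_sub, transpose_mul, transpose_transpose, Matrix.mul_sub,
    Matrix.sub_mul, trace_sub, trace_add, trace_smul, smul_eq_mul, Matrix.mul_one,
    Matrix.one_mul, h₁, h₂, h₃, h₄]
  ring

theorem abs_trace_FAC_remainder_le {m₁ m₂ : ℕ} {κ : ℝ} (hκ : 3 * (m₂ : ℝ) + 1 ≤ κ)
    {U V : Matrix (Fin m₁) (Fin m₂) ℝ}
    (hU : frobNorm U ≤ Real.sqrt m₂) (hV : frobNorm V ≤ Real.sqrt m₂) :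
    |trace (FAC U) - trace (FAC V) + frobInner (U - V) (fAC V)| ≤
      κ / 2 * frobNorm (U - V) ^ 2 := by
  rw [trace_FAC_remainder]
  set D := U - V
  have hs : Real.sqrt m₂ ^ 2 = m₂ := Real.sq_sqrt (Nat.cast_nonneg _)
  have hD := frobNorm_nonneg D
  have h₁ : frobNorm (Uᵀ * D + Dᵀ * V) ≤ 2 * Real.sqrt m₂ * frobNorm D := by
    have hUD := frobNorm_mul_le Uᵀ D
    have hDV := frobNorm_mul_le Dᵀ V
    rw [frobNorm_transpose] at hUD hDV
    have := frobNorm_add_le (Uᵀ * D) (Dᵀ * V)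
    nlinarith
  have h₂ : frobNorm (V * Dᵀ) ≤ Real.sqrt m₂ * frobNorm D := by
    have hVD := frobNorm_mul_le V Dᵀ
    rw [frobNorm_transpose] at hVD
    nlinarith
  have h₁' := pow_le_pow_left₀ (frobNorm_nonneg _) h₁ 2
  have h₂' := pow_le_pow_left₀ (frobNorm_nonneg _) h₂ 2
  rw [mul_pow, mul_pow, hs] at h₁'
  rw [mul_pow, hs] at h₂'
  have hκD := mul_le_mul_of_nonneg_right hκ (sq_nonneg (frobNorm D))
  have hmD : 0 ≤ (m₂ : ℝ) * frobNorm D ^ 2 := by positivity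
  rw [abs_le]
  constructor
  · nlinarith [sq_nonneg (frobNorm (Uᵀ * D + Dᵀ * V)), sq_nonneg (frobNorm (V * Dᵀ))]
  · nlinarith [sq_nonneg (frobNorm D)]

theorem continuous_trace_FAC_remainder {m₁ m₂ : ℕ} :
    Continuous fun p : Matrix (Fin m₁) (Fin m₂) ℝ × Matrix (Fin m₁) (Fin m₂) ℝ =>
      trace (FAC p.1) - trace (FAC p.2) + frobInner (p.1 - p.2) (fAC p.2) := by
  have hF : Continuous fun W : Matrix (Fin m₁) (Fin m₂) ℝ => trace (FAC W) :=
    ((((continuous_id.matrix_transpose.matrix_mul continuous_id).sub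
      continuous_const).pow 2).const_smul (1 / 4 : ℝ)).matrix_trace
  have hf : Continuous fun W : Matrix (Fin m₁) (Fin m₂) ℝ => fAC W :=
    continuous_id.sub ((continuous_id.matrix_mul continuous_id.matrix_transpose).matrix_mul
      continuous_id)
  exact ((hF.comp continuous_fst).sub (hF.comp continuous_snd)).add
    (((continuous_fst.sub continuous_snd).matrix_transpose.matrix_mul
      (hf.comp continuous_snd)).matrix_trace)

/-- Integral convexity-splitting inequality (Lemma 3.4):
`∫ (tr F(U) − tr F(V) + ⟨U − V, f(V)⟩_F) dμ ≤ (κ/2) ∫ ‖U − V‖_F² dμ`. -/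
theorem stmt_7 (m₁ m₂ : ℕ) (hm₂ : 1 ≤ m₂) (hm : m₂ ≤ m₁)
    (κ : ℝ) (hκ : 3 * (m₂ : ℝ) + 1 ≤ κ)
    {Ω : Type*} [MeasurableSpace Ω] (μ : Measure Ω) [IsFiniteMeasure μ]
    (U V : Ω → Matrix (Fin m₁) (Fin m₂) ℝ)
    (hUmeas : StronglyMeasurable U) (hVmeas : StronglyMeasurable V)
    (hU : ∀ᵐ x ∂μ, frobNorm (U x) ≤ Real.sqrt m₂)
    (hV : ∀ᵐ x ∂μ, frobNorm (V x) ≤ Real.sqrt m₂) :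
    ∫ x, (trace (FAC (U x)) - trace (FAC (V x))
        + frobInner (U x - V x) (fAC (V x))) ∂μ
      ≤ κ / 2 * ∫ x, frobNorm (U x - V x) ^ 2 ∂μ := by
  have hmeasD : StronglyMeasurable fun x => frobNorm (U x - V x) ^ 2 := by
    have hc : Continuous fun W : Matrix (Fin m₁) (Fin m₂) ℝ => frobNorm W ^ 2 := by
      unfold frobNorm
      fun_prop
    exact hc.comp_stronglyMeasurable (hUmeas.sub hVmeas)
  have hmeas : StronglyMeasurable fun x => trace (FAC (U x)) - trace (FAC (V x))
      + frobInner (U x - V x) (fAC (V x)) := by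
    have hUV : StronglyMeasurable fun x => (U x, V x) := hUmeas.prodMk hVmeas
    have h := continuous_trace_FAC_remainder.comp_stronglyMeasurable hUV
    exact h
  have hD : Integrable (fun x => frobNorm (U x - V x) ^ 2) μ := by
    refine Integrable.of_bound hmeasD.aestronglyMeasurable
      ((Real.sqrt m₂ + Real.sqrt m₂) ^ 2) ?_
    filter_upwards [hU, hV] with x hUx hVx
    rw [Real.norm_of_nonneg (sq_nonneg _)]
    exact pow_le_pow_left₀ (frobNorm_nonneg _)
      ((frobNorm_sub_le _ _).trans (add_le_add hUx hVx)) 2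
  have hbound : ∀ᵐ x ∂μ, |trace (FAC (U x)) - trace (FAC (V x))
      + frobInner (U x - V x) (fAC (V x))| ≤ κ / 2 * frobNorm (U x - V x) ^ 2 := by
    filter_upwards [hU, hV] with x hUx hVx
    exact abs_trace_FAC_remainder_le hκ hUx hVx
  have hκD := hD.const_mul (κ / 2)
  rw [← integral_const_mul]
  exact integral_mono_ae (hκD.mono' hmeas.aestronglyMeasurable hbound) hκD
    (hbound.mono fun x hx => (le_abs_self _).trans hx)
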